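/- arXiv:2109.07632 — 2 statements merged into one kernel-verified Lean document; each statement's English description precedes it below -/
import Mathlib

section
/- Let n ≥ 1 and let A_min, A_max be real n×n matrices with A_min[i,j] ≤ A_max[i,j] for all i,j. Let C := (A_min + A_max)/2 and Δ := (A_max − A_min)/2. Then sup { ‖E‖₂ : E is a real n×n matrix with A_min[i,j] ≤ E[i,j] ≤ A_max[i,j] for all i,j } equals the maximum, over all sign vectors y, z ∈ {−1, +1}ⁿ, of ‖ C + (y·zᵀ) ⊙ Δ ‖₂, where (y·zᵀ) ⊙ Δ denotes the matrix whose [i,j] entry is y[i]·z[j]·Δ[i,j]. -/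
/-- The ℓ²→ℓ² operator norm of a real n×n matrix. -/
noncomputable def opNorm2 {n : ℕ} (M : Matrix (Fin n) (Fin n) ℝ) : ℝ :=
  ‖Matrix.toEuclideanCLM (𝕜 := ℝ) M‖

lemma inner_toEuclideanCLM {n : ℕ} (M : Matrix (Fin n) (Fin n) ℝ)
    (u v : EuclideanSpace ℝ (Fin n)) :
    inner ℝ u (Matrix.toEuclideanCLM (𝕜 := ℝ) M v) = ∑ i, ∑ j, u i * M i j * v j := by
  simp only [PiLp.inner_apply, Matrix.ofLp_toEuclideanCLM, Matrix.mulVec, dotProduct,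
    RCLike.inner_apply, conj_trivial, Finset.sum_mul]
  exact Finset.sum_congr rfl fun i _ => Finset.sum_congr rfl fun j _ => by ring

lemma exists_sign_mul_eq_abs {n : ℕ} (u : Fin n → ℝ) :
    ∃ y : Fin n → ℝ, (∀ i, y i = 1 ∨ y i = -1) ∧ ∀ i, u i * y i = |u i| := by
  have h (i : Fin n) : ∃ s : ℝ, (s = 1 ∨ s = -1) ∧ u i * s = |u i| := by
    rcases abs_choice (u i) with h | h
    · exact ⟨1, Or.inl rfl, by simp [h]⟩
    · exact ⟨-1, Or.inr rfl, by simp [h]⟩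
  choose y hy hyu using h
  exact ⟨y, hy, hyu⟩

lemma exists_sign_inner_le {n : ℕ} {C Δ E : Matrix (Fin n) (Fin n) ℝ}
    (hE : ∀ i j, |E i j - C i j| ≤ Δ i j) (u v : EuclideanSpace ℝ (Fin n)) :
    ∃ y z : Fin n → ℝ, (∀ i, y i = 1 ∨ y i = -1) ∧ (∀ i, z i = 1 ∨ z i = -1) ∧
      inner ℝ u (Matrix.toEuclideanCLM (𝕜 := ℝ) E v) ≤
        inner ℝ u (Matrix.toEuclideanCLM (𝕜 := ℝ)
          (C + Matrix.of (fun i j => y i * z j * Δ i j)) v) := by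
  obtain ⟨y, hy, hyu⟩ := exists_sign_mul_eq_abs u
  obtain ⟨z, hz, hzv⟩ := exists_sign_mul_eq_abs v
  refine ⟨y, z, hy, hz, ?_⟩
  rw [inner_toEuclideanCLM, inner_toEuclideanCLM]
  refine Finset.sum_le_sum fun i _ => Finset.sum_le_sum fun j _ => ?_
  have hbound : u i * v j * (E i j - C i j) ≤ |u i| * |v j| * Δ i j := by
    refine (le_abs_self _).trans ?_
    rw [abs_mul, abs_mul]
    exact mul_le_mul_of_nonneg_left (hE i j) (by positivity)
  rw [← hyu, ← hzv] at hbound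
  simp only [Matrix.add_apply, Matrix.of_apply]
  linarith

lemma finite_sign_vertex_norms {n : ℕ} (C Δ : Matrix (Fin n) (Fin n) ℝ) :
    {r : ℝ | ∃ y z : Fin n → ℝ,
        (∀ i, y i = 1 ∨ y i = -1) ∧ (∀ i, z i = 1 ∨ z i = -1) ∧
        r = opNorm2 (C + Matrix.of (fun i j => y i * z j * Δ i j))}.Finite := by
  have hfin : (Set.univ.pi fun _ : Fin n => ({1, -1} : Set ℝ)).Finite :=
    Set.Finite.pi' (fun _ => Set.toFinite _) |>.subset fun y hy i => hy i trivial
  refine (hfin.image2 (fun y z => opNorm2 (C + Matrix.of (fun i j => y i * z j * Δ i j)))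
    hfin).subset ?_
  rintro r ⟨y, z, hy, hz, rfl⟩
  exact ⟨y, fun i _ => hy i, z, fun i _ => hz i, rfl⟩

lemma opNorm2_le_of_sign_vertices {n : ℕ} {C Δ E : Matrix (Fin n) (Fin n) ℝ}
    (hE : ∀ i j, |E i j - C i j| ≤ Δ i j) {S : ℝ}
    (hS : ∀ y z : Fin n → ℝ, (∀ i, y i = 1 ∨ y i = -1) → (∀ i, z i = 1 ∨ z i = -1) →
      opNorm2 (C + Matrix.of (fun i j => y i * z j * Δ i j)) ≤ S) :
    opNorm2 E ≤ S := by
  have hS0 : 0 ≤ S :=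
    (norm_nonneg _).trans (hS 1 1 (fun _ => Or.inl rfl) (fun _ => Or.inl rfl))
  refine ContinuousLinearMap.opNorm_le_bound _ hS0 fun v => ?_
  set w := Matrix.toEuclideanCLM (𝕜 := ℝ) E v with hw
  obtain ⟨y, z, hy, hz, hle⟩ := exists_sign_inner_le hE w v
  rw [← hw, real_inner_self_eq_norm_sq] at hle
  have hF := ((Matrix.toEuclideanCLM (𝕜 := ℝ)
    (C + Matrix.of (fun i j => y i * z j * Δ i j))).le_of_opNorm_le (hS y z hy hz) v)
  have hsq : ‖w‖ * ‖w‖ ≤ ‖w‖ * (S * ‖v‖) := by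
    rw [← sq]
    exact hle.trans ((real_inner_le_norm _ _).trans
      (mul_le_mul_of_nonneg_left hF (norm_nonneg w)))
  rcases (norm_nonneg w).eq_or_lt with h0 | hpos
  · rw [← h0]
    positivity
  · exact le_of_mul_le_mul_left hsq hpos

theorem l2_norm_interval_matrix {n : ℕ} (hn : 1 ≤ n)
    (Amin Amax : Matrix (Fin n) (Fin n) ℝ)
    (hle : ∀ i j, Amin i j ≤ Amax i j)
    (C Δ : Matrix (Fin n) (Fin n) ℝ)
    (hC : C = (1 / 2 : ℝ) • (Amin + Amax))
    (hΔ : Δ = (1 / 2 : ℝ) • (Amax - Amin)) :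
    sSup {r : ℝ | ∃ E : Matrix (Fin n) (Fin n) ℝ,
        (∀ i j, Amin i j ≤ E i j ∧ E i j ≤ Amax i j) ∧ r = opNorm2 E} =
      sSup {r : ℝ | ∃ y z : Fin n → ℝ,
        (∀ i, y i = 1 ∨ y i = -1) ∧ (∀ i, z i = 1 ∨ z i = -1) ∧
        r = opNorm2 (C + Matrix.of (fun i j => y i * z j * Δ i j))} := by
  have hCij (i j) : C i j = (Amin i j + Amax i j) / 2 := by
    simp [hC]; ring
  have hΔij (i j) : Δ i j = (Amax i j - Amin i j) / 2 := by
    simp [hΔ]; ring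
  have hbound (E : Matrix (Fin n) (Fin n) ℝ)
      (hE : ∀ i j, Amin i j ≤ E i j ∧ E i j ≤ Amax i j) :
      opNorm2 E ≤ sSup {r : ℝ | ∃ y z : Fin n → ℝ,
        (∀ i, y i = 1 ∨ y i = -1) ∧ (∀ i, z i = 1 ∨ z i = -1) ∧
        r = opNorm2 (C + Matrix.of (fun i j => y i * z j * Δ i j))} := by
    refine opNorm2_le_of_sign_vertices (C := C) (Δ := Δ) (fun i j => ?_) fun y z hy hz =>
      le_csSup (finite_sign_vertex_norms C Δ).bddAbove ⟨y, z, hy, hz, rfl⟩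
    rw [hCij, hΔij, abs_le]
    constructor <;> linarith [hE i j]
  apply le_antisymm
  · refine csSup_le ⟨_, Amin, fun i j => ⟨le_rfl, hle i j⟩, rfl⟩ ?_
    rintro r ⟨E, hE, rfl⟩
    exact hbound E hE
  · refine csSup_le ⟨_, 1, 1, fun _ => Or.inl rfl, fun _ => Or.inl rfl, rfl⟩ ?_
    rintro r ⟨y, z, hy, hz, rfl⟩
    refine le_csSup ⟨_, fun r ⟨E, hE, hr⟩ => hr.trans_le (hbound E hE)⟩
      ⟨_, fun i j => ?_, rfl⟩
    simp only [Matrix.add_apply, Matrix.of_apply, hCij, hΔij]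
    rcases hy i with h | h <;> rcases hz j with h' | h' <;> rw [h, h'] <;>
      constructor <;> linarith [hle i j]
end

section
/- Let n, m ≥ 1, let A_min, A_max be real n×n matrices with A_min[i,k] ≤ A_max[i,k] for all i,k, let a ∈ ℝⁿ, let g_1, …, g_m ∈ ℝⁿ, and let c_low, c_high ∈ ℝᵐ with c_low[j] ≤ c_high[j] for all j. For each i and j define L[j,i] := Σ_k min( A_min[i,k]·g_j[k], A_max[i,k]·g_j[k] ), H[j,i] := Σ_k max( A_min[i,k]·g_j[k], A_max[i,k]·g_j[k] ), d_low[i] := Σ_k min( A_min[i,k]·a[k], A_max[i,k]·a[k] ) + Σ_j min( c_low[j]·L[j,i], c_low[j]·H[j,i], c_high[j]·L[j,i], c_high[j]·H[j,i] ), and d_high[i] := Σ_k max( A_min[i,k]·a[k], A_max[i,k]·a[k] ) + Σ_j max( c_low[j]·L[j,i], c_low[j]·H[j,i], c_high[j]·L[j,i], c_high[j]·H[j,i] ). Then for every real n×n matrix E with A_min[i,k] ≤ E[i,k] ≤ A_max[i,k] for all i,k, and every α ∈ ℝᵐ with c_low[j] ≤ α[j] ≤ c_high[j] for all j, and every index i,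 d_low[i] ≤ ( E · ( a + Σ_{j=1}^m α[j]·g_j ) )[i] ≤ d_high[i]. -/
theorem mul_mem_Icc_min_max {l u x : ℝ} (hl : l ≤ x) (hu : x ≤ u) (y : ℝ) :
    min (l * y) (u * y) ≤ x * y ∧ x * y ≤ max (l * y) (u * y) := by
  rcases le_total 0 y with hy | hy
  · exact ⟨min_le_of_left_le (mul_le_mul_of_nonneg_right hl hy),
      le_max_of_le_right (mul_le_mul_of_nonneg_right hu hy)⟩
  · exact ⟨min_le_of_right_le (mul_le_mul_of_nonpos_right hu hy),
      le_max_of_le_left (mul_le_mul_of_nonpos_right hl hy)⟩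

theorem mul_mem_Icc_corners {l u x p q y : ℝ} (hl : l ≤ x) (hu : x ≤ u)
    (hp : p ≤ y) (hq : y ≤ q) :
    min (min (l * p) (l * q)) (min (u * p) (u * q)) ≤ x * y ∧
      x * y ≤ max (max (l * p) (l * q)) (max (u * p) (u * q)) := by
  have hx := mul_mem_Icc_min_max hl hu y
  have hcorner (c : ℝ) : min (c * p) (c * q) ≤ c * y ∧ c * y ≤ max (c * p) (c * q) := by
    simpa only [mul_comm c] using mul_mem_Icc_min_max hp hq c
  exact ⟨(min_le_min (hcorner l).1 (hcorner u).1).trans hx.1,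
    hx.2.trans (max_le_max (hcorner l).2 (hcorner u).2)⟩

theorem mulVec_mem_Icc_of_interval {ι κ : Type*} [Fintype κ] {A B E : Matrix ι κ ℝ}
    (hE : ∀ i k, A i k ≤ E i k ∧ E i k ≤ B i k) (v : κ → ℝ) (i : ι) :
    ∑ k, min (A i k * v k) (B i k * v k) ≤ E.mulVec v i ∧
      E.mulVec v i ≤ ∑ k, max (A i k * v k) (B i k * v k) :=
  ⟨Finset.sum_le_sum fun k _ => (mul_mem_Icc_min_max (hE i k).1 (hE i k).2 (v k)).1,
    Finset.sum_le_sum fun k _ => (mul_mem_Icc_min_max (hE i k).1 (hE i k).2 (v k)).2⟩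

theorem star_interval_transform_bound {n m : ℕ} (hn : 1 ≤ n) (hm : 1 ≤ m)
    (Amin Amax : Matrix (Fin n) (Fin n) ℝ)
    (hle : ∀ i k, Amin i k ≤ Amax i k)
    (a : Fin n → ℝ) (g : Fin m → Fin n → ℝ)
    (clow chigh : Fin m → ℝ) (hc : ∀ j, clow j ≤ chigh j)
    (L H : Fin m → Fin n → ℝ)
    (hL : ∀ j i, L j i = ∑ k, min (Amin i k * g j k) (Amax i k * g j k))
    (hH : ∀ j i, H j i = ∑ k, max (Amin i k * g j k) (Amax i k * g j k))
    (dlow dhigh : Fin n → ℝ)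
    (hdlow : ∀ i, dlow i =
      (∑ k, min (Amin i k * a k) (Amax i k * a k)) +
        ∑ j, min (min (clow j * L j i) (clow j * H j i))
                 (min (chigh j * L j i) (chigh j * H j i)))
    (hdhigh : ∀ i, dhigh i =
      (∑ k, max (Amin i k * a k) (Amax i k * a k)) +
        ∑ j, max (max (clow j * L j i) (clow j * H j i))
                 (max (chigh j * L j i) (chigh j * H j i)))
    (E : Matrix (Fin n) (Fin n) ℝ)
    (hE : ∀ i k, Amin i k ≤ E i k ∧ E i k ≤ Amax i k)
    (α : Fin m → ℝ) (hα : ∀ j, clow j ≤ α j ∧ α j ≤ chigh j)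
    (i : Fin n) :
    dlow i ≤ E.mulVec (a + ∑ j, α j • g j) i ∧
      E.mulVec (a + ∑ j, α j • g j) i ≤ dhigh i := by
  have hexpand : E.mulVec (a + ∑ j, α j • g j) i =
      E.mulVec a i + ∑ j, α j * E.mulVec (g j) i := by
    simp [Matrix.mulVec_add, Matrix.mulVec_sum, Matrix.mulVec_smul, Finset.sum_apply]
  have ha := mulVec_mem_Icc_of_interval hE a i
  have hg (j : Fin m) := mul_mem_Icc_corners (hα j).1 (hα j).2
    ((hL j i).trans_le (mulVec_mem_Icc_of_interval hE (g j) i).1)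
    ((mulVec_mem_Icc_of_interval hE (g j) i).2.trans_eq (hH j i).symm)
  rw [hexpand, hdlow, hdhigh]
  exact ⟨add_le_add ha.1 (Finset.sum_le_sum fun j _ => (hg j).1),
    add_le_add ha.2 (Finset.sum_le_sum fun j _ => (hg j).2)⟩
end
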